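/- Let K be a field, d ∈ K, and consider the Temperley–Lieb category over (K,d). Let n, m ∈ ℕ, let p ∈ T_n be a minimal idempotent, and let f ∈ T_{n+m} satisfy (p⊗1_m)∘f∘(p⊗1_m) = f. Then there exists a scalar γ ∈ K such that ε_{n,n+m}(f) = γ·p and Tr_{n+m}(f) = γ·Tr_n(p). -/

import Mathlib

/-!
Common definitions: the Temperley–Lieb category over a field `K` with loop
parameter `d`.

An `(m,n)`-Temperley–Lieb diagram is a noncrossing perfect matching of `m`
marked points on the top edge and `n` marked points on the bottom edge of a
rectangle.  We encode it as a fixed-point-free involution of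
`Fin m ⊕ Fin n` (`Sum.inl i` is the `i`-th top point, `Sum.inr j` the `j`-th
bottom point) which is noncrossing with respect to the boundary order of the
points (top points from left to right, then bottom points from right to left).
-/

open scoped Classical

namespace TL

/-- The position of a marked point in the linear boundary order of the
rectangle: top points `0, …, m-1` from left to right, then bottom points
from right to left. -/
def bIdx (m n : ℕ) : Fin m ⊕ Fin n → ℕ
  | Sum.inl i => (i : ℕ)
  | Sum.inr j => m + (n - 1 - (j : ℕ))

/-- An `(m,n)`-Temperley–Lieb diagram: a noncrossing perfect matching
(= fixed-point-free involution) of the `m` top points and `n` bottom points. -/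
structure Diagram (m n : ℕ) where
  pair : Fin m ⊕ Fin n → Fin m ⊕ Fin n
  involutive : Function.Involutive pair
  fixedPointFree : ∀ x, pair x ≠ x
  noncrossing : ∀ x y, ¬ (bIdx m n x < bIdx m n y ∧ bIdx m n y < bIdx m n (pair x) ∧
      bIdx m n (pair x) < bIdx m n (pair y))

noncomputable instance (m n : ℕ) : Fintype (Diagram m n) :=
  Fintype.ofInjective (fun D => D.pair)
    (fun a b h => by cases a; cases b; simpa using h)

/-- `Hom K m n` is the `K`-vector space of morphisms from `m` to `n`:
the free vector space on the set of `(m,n)`-TL diagrams, realized as the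
space of `K`-valued functions on the (finite) set of diagrams. -/
abbrev Hom (K : Type) [Field K] (m n : ℕ) : Type := Diagram m n → K

variable {K : Type} [Field K]

/-- The basis vector of `Hom K m n` corresponding to a single diagram. -/
noncomputable def single {m n : ℕ} (p : Diagram m n) : Hom K m n :=
  fun c => if c = p then 1 else 0

/-! ### Composition -/

/-- The marked points of the picture obtained by stacking an `(l,m)`-diagram
on top of an `(m,n)`-diagram: `l` top points, `m` middle points, `n` bottom
points. -/
abbrev Pt (l m n : ℕ) := Fin l ⊕ (Fin m ⊕ Fin n)

/-- One strand of the stacked picture: either a strand of the top diagram `a`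
(on the `l` top and `m` middle points) or a strand of the bottom diagram `b`
(on the `m` middle and `n` bottom points). -/
def Step {l m n : ℕ} (a : Diagram l m) (b : Diagram m n) : Pt l m n → Pt l m n → Prop :=
  fun x y =>
    (∃ u : Fin l ⊕ Fin m, Sum.map id Sum.inl u = x ∧ Sum.map id Sum.inl (a.pair u) = y) ∨
    (∃ u : Fin m ⊕ Fin n, Sum.inr u = x ∧ Sum.inr (b.pair u) = y)

/-- Connectivity in the stacked picture: two marked points are connected if
they are joined by a path of strands. -/
def Conn {l m n : ℕ} (a : Diagram l m) (b : Diagram m n) : Pt l m n → Pt l m n → Prop :=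
  Relation.EqvGen (Step a b)

/-- The points of the middle layer whose connected component stays entirely in
the middle layer; these components are exactly the closed loops produced when
stacking. -/
def ClosedMid {l m n : ℕ} (a : Diagram l m) (b : Diagram m n) : Set (Pt l m n) :=
  {x | (∃ j : Fin m, x = Sum.inr (Sum.inl j)) ∧
    ∀ y, Conn a b x y → ∃ j : Fin m, y = Sum.inr (Sum.inl j)}

/-- The number of closed loops produced when stacking `a` on top of `b`:
the number of connected components consisting entirely of middle points. -/
noncomputable def numLoops {l m n : ℕ} (a : Diagram l m) (b : Diagram m n) : ℕ :=
  Nat.card (Quotient (⟨fun x y : ClosedMid a b => Conn a b x.1 y.1,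
    ⟨fun _ => Relation.EqvGen.refl _, fun h => Relation.EqvGen.symm _ _ h,
      fun h h' => Relation.EqvGen.trans _ _ _ h h'⟩⟩ : Setoid (ClosedMid a b)))

/-- Composition of two diagrams `b ∘ a` (stack `a` on top of `b`, delete the
`r` closed loops, multiply by `d ^ r`), expressed as an element of
`Hom K l n`: the result is `d ^ r` times the unique `(l,n)`-diagram inducing
the same pairing of the outer points as the connectivity of the stacked
picture. -/
noncomputable def compD (d : K) {l m n : ℕ} (b : Diagram m n) (a : Diagram l m) :
    Hom K l n :=
  fun c =>
    if ∀ x : Fin l ⊕ Fin n,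
        Conn a b (Sum.map id Sum.inr x) (Sum.map id Sum.inr (c.pair x))
    then d ^ numLoops a b else 0

/-- Composition `b ∘ a : Hom K l n` of `b : Hom K m n` with `a : Hom K l m`
(bilinear extension of composition of diagrams). -/
noncomputable def comp (d : K) {l m n : ℕ} (b : Hom K m n) (a : Hom K l m) :
    Hom K l n :=
  fun c => ∑ p : Diagram m n, ∑ q : Diagram l m, b p * a q * compD d p q c

/-! ### Tensor product -/

/-- Relabelling of the marked points of a horizontal juxtaposition of an
`(m,n)`-diagram (placed on the left) and an `(m',n')`-diagram (on the right). -/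
def tEquiv (m n m' n' : ℕ) :
    (Fin (m + m') ⊕ Fin (n + n')) ≃ ((Fin m ⊕ Fin n) ⊕ (Fin m' ⊕ Fin n')) :=
  (Equiv.sumCongr finSumFinEquiv.symm finSumFinEquiv.symm).trans
    (Equiv.sumSumSumComm _ _ _ _)

/-- The pairing of the horizontal juxtaposition of two diagrams. -/
def tensorPair {m n m' n' : ℕ} (a : Diagram m n) (b : Diagram m' n') :
    Fin (m + m') ⊕ Fin (n + n') → Fin (m + m') ⊕ Fin (n + n') :=
  fun x => (tEquiv m n m' n').symm (Sum.map a.pair b.pair (tEquiv m n m' n' x))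

/-- The tensor product (horizontal juxtaposition) of two diagrams, as an
element of `Hom K (m+m') (n+n')`: the basis vector of the unique diagram whose
pairing is the juxtaposed pairing. -/
noncomputable def tensorD {m n m' n' : ℕ} (a : Diagram m n) (b : Diagram m' n') :
    Hom K (m + m') (n + n') :=
  fun c => if c.pair = tensorPair a b then 1 else 0

/-- The tensor product of morphisms (bilinear extension of horizontal
juxtaposition of diagrams). -/
noncomputable def tensor {m n m' n' : ℕ} (x : Hom K m n) (y : Hom K m' n') :
    Hom K (m + m') (n + n') :=
  fun c => ∑ p : Diagram m n, ∑ q : Diagram m' n', x p * y q * tensorD p q c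

/-! ### Identity, cup and cap -/

/-- The identity diagram `1_n`: `n` vertical strands. -/
def idD (n : ℕ) : Diagram n n where
  pair := Sum.elim Sum.inr Sum.inl
  involutive := by rintro (i | i) <;> rfl
  fixedPointFree := by rintro (i | i) <;> simp
  noncrossing := by
    rintro (i | i) (j | j) <;>
      · simp only [Sum.elim_inl, Sum.elim_inr, bIdx]
        have hi := i.isLt; have hj := j.isLt; omega

/-- The identity morphism `1_n ∈ T_n`. -/
noncomputable def idHom (K : Type) [Field K] (n : ℕ) : Hom K n n :=
  fun c => if c = idD n then 1 else 0

/-- The cap `∩`: the unique `(0,2)`-TL diagram. -/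
def capD : Diagram 0 2 where
  pair := fun x => match x with
    | Sum.inl i => i.elim0
    | Sum.inr j => Sum.inr ⟨1 - (j : ℕ), by omega⟩
  involutive := by intro x; revert x; decide
  fixedPointFree := by decide
  noncrossing := by decide

/-- The cup `∪`: the unique `(2,0)`-TL diagram. -/
def cupD : Diagram 2 0 where
  pair := fun x => match x with
    | Sum.inl j => Sum.inl ⟨1 - (j : ℕ), by omega⟩
    | Sum.inr i => i.elim0
  involutive := by intro x; revert x; decide
  fixedPointFree := by decide
  noncrossing := by decide

/-- The cap `∩` as a morphism in `Hom K 0 2`. -/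
noncomputable def capHom (K : Type) [Field K] : Hom K 0 2 :=
  fun c => if c = capD then 1 else 0

/-- The cup `∪` as a morphism in `Hom K 2 0`. -/
noncomputable def cupHom (K : Type) [Field K] : Hom K 2 0 :=
  fun c => if c = cupD then 1 else 0

/-! ### The Markov trace -/

/-- The strands of the picture obtained from an `(n,n)`-diagram `p` by closing
it up: joining, for each `i`, the `i`-th top point to the `i`-th bottom point
(by nested arcs passing to the right of the rectangle). -/
def closeStep {n : ℕ} (p : Diagram n n) : (Fin n ⊕ Fin n) → (Fin n ⊕ Fin n) → Prop :=
  fun x y => p.pair x = y ∨ Sum.elim Sum.inr Sum.inl x = y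

/-- The number `c(p)` of closed loops of the closure of an `(n,n)`-diagram. -/
noncomputable def trLoops {n : ℕ} (p : Diagram n n) : ℕ :=
  Nat.card (Quotient (Relation.EqvGen.setoid (closeStep p)))

/-- The Markov trace `Tr_n : T_n → K`, sending a diagram `p` to
`d ^ c(p)`. -/
noncomputable def Tr (d : K) {n : ℕ} (x : Hom K n n) : K :=
  ∑ p : Diagram n n, x p * d ^ trLoops p

/-! ### Conditional expectations -/

/-- The conditional expectation `ε_n : T_{n+1} → T_n`,
`a ↦ (1_n ⊗ ∪) ∘ (a ⊗ 1_1) ∘ (1_n ⊗ ∩)` (closing up the last strand). -/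
noncomputable def eps (d : K) (n : ℕ) (a : Hom K (n + 1) (n + 1)) : Hom K n n :=
  let u : Hom K n (n + 2) := tensor (idHom K n) (capHom K)
  let v : Hom K (n + 2) (n + 2) := @tensor K _ (n + 1) (n + 1) 1 1 a (idHom K 1)
  let w : Hom K (n + 2) n := tensor (idHom K n) (cupHom K)
  comp d w (comp d v u)

/-- The iterated conditional expectation `ε_{n,n+m} = ε_n ∘ ε_{n+1} ∘ ⋯ ∘ ε_{n+m-1} :
T_{n+m} → T_n`. -/
noncomputable def epsIter (d : K) (n : ℕ) : (m : ℕ) → Hom K (n + m) (n + m) → Hom K n n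
  | 0, a => a
  | m + 1, a => epsIter d n m (eps d (n + m) a)

/-! ### Tensor powers of cup and cap -/

/-- `∩^{⊗k} ∈ Hom(0, 2k)`. -/
noncomputable def capPow (K : Type) [Field K] : (k : ℕ) → Hom K 0 (2 * k)
  | 0 => idHom K 0
  | k + 1 => tensor (capPow K k) (capHom K)

/-- `∪^{⊗k} ∈ Hom(2k, 0)`. -/
noncomputable def cupPow (K : Type) [Field K] : (k : ℕ) → Hom K (2 * k) 0
  | 0 => idHom K 0
  | k + 1 => tensor (cupPow K k) (cupHom K)

/-! ### Ideals -/

/-- An ideal of the Temperley–Lieb category over `(K, d)`: a family of vector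
subspaces `J m n ⊆ Hom K m n` closed under composition with arbitrary
morphisms on either side and under tensor product with arbitrary morphisms on
either side. -/
structure IsIdeal (d : K) (J : ∀ m n : ℕ, Set (Hom K m n)) : Prop where
  zero_mem : ∀ m n : ℕ, (0 : Hom K m n) ∈ J m n
  add_mem : ∀ (m n : ℕ), ∀ x ∈ J m n, ∀ y ∈ J m n, x + y ∈ J m n
  smul_mem : ∀ (m n : ℕ) (c : K), ∀ x ∈ J m n, c • x ∈ J m n
  comp_mem_left : ∀ {l m n : ℕ} (b : Hom K m n) (a : Hom K l m),
    a ∈ J l m → comp d b a ∈ J l n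
  comp_mem_right : ∀ {l m n : ℕ} (b : Hom K m n) (a : Hom K l m),
    b ∈ J m n → comp d b a ∈ J l n
  tensor_mem_left : ∀ {m n m' n' : ℕ} (x : Hom K m n) (y : Hom K m' n'),
    x ∈ J m n → tensor x y ∈ J (m + m') (n + n')
  tensor_mem_right : ∀ {m n m' n' : ℕ} (x : Hom K m n) (y : Hom K m' n'),
    y ∈ J m' n' → tensor x y ∈ J (m + m') (n + n')

/-- An ideal is nonzero if some `J m n` contains a nonzero morphism. -/
def IdealNonzero (J : ∀ m n : ℕ, Set (Hom K m n)) : Prop :=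
  ∃ (m n : ℕ) (x : Hom K m n), x ∈ J m n ∧ x ≠ 0

/-- An ideal is proper if it does not contain all morphisms. -/
def IdealProper (J : ∀ m n : ℕ, Set (Hom K m n)) : Prop :=
  ∃ m n : ℕ, J m n ≠ Set.univ

/-- The negligible morphisms: `a ∈ Hom(m,n)` with `Tr_m (b ∘ a) = 0` for all
`b ∈ Hom(n,m)`. -/
def Negl (d : K) (m n : ℕ) : Set (Hom K m n) :=
  {a | ∀ b : Hom K n m, Tr d (comp d b a) = 0}

/-- The ideal generated by a morphism `x ∈ Hom K a b`: the smallest ideal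
containing `x`, i.e. the intersection of all ideals containing `x`. -/
def genIdeal (d : K) {a b : ℕ} (x : Hom K a b) (m n : ℕ) : Set (Hom K m n) :=
  {y | ∀ J : ∀ m' n' : ℕ, Set (Hom K m' n'), IsIdeal d J → x ∈ J a b → y ∈ J m n}

/-! ### Jones–Wenzl idempotents -/

/-- The diagram `E_i ∈ T_n` (here `i` is 0-indexed, `i + 1 < n`): it joins the
`i`-th and `(i+1)`-st top points, the `i`-th and `(i+1)`-st bottom points, and
joins the `j`-th top point vertically to the `j`-th bottom point for all other
`j`; encoded as a pairing function. -/
def eiPair (n i : ℕ) : Fin n ⊕ Fin n → Fin n ⊕ Fin n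
  | Sum.inl j =>
      if (j : ℕ) = i then
        Sum.inl ⟨((j : ℕ) + 1) % n, Nat.mod_lt _ (Nat.lt_of_le_of_lt (Nat.zero_le _) j.isLt)⟩
      else if (j : ℕ) = i + 1 then
        Sum.inl ⟨(j : ℕ) - 1, Nat.lt_of_le_of_lt (Nat.sub_le _ _) j.isLt⟩
      else Sum.inr j
  | Sum.inr j =>
      if (j : ℕ) = i then
        Sum.inr ⟨((j : ℕ) + 1) % n, Nat.mod_lt _ (Nat.lt_of_le_of_lt (Nat.zero_le _) j.isLt)⟩
      else if (j : ℕ) = i + 1 then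
        Sum.inr ⟨(j : ℕ) - 1, Nat.lt_of_le_of_lt (Nat.sub_le _ _) j.isLt⟩
      else Sum.inl j

/-- The morphism `E_i ∈ T_n` (0-indexed `i`). -/
noncomputable def EHom (K : Type) [Field K] (n i : ℕ) : Hom K n n :=
  fun c => if c.pair = eiPair n i then 1 else 0

/-- A Jones–Wenzl idempotent in `T_n`: a nonzero idempotent `p` with
`E_i ∘ p = p ∘ E_i = 0` for all `i` (1-indexed `1 ≤ i ≤ n-1`; here `i` is
0-indexed, so `i + 2 ≤ n`). -/
def IsJonesWenzl (d : K) (n : ℕ) (p : Hom K n n) : Prop :=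
  p ≠ 0 ∧ comp d p p = p ∧
    ∀ i : ℕ, i + 2 ≤ n → comp d (EHom K n i) p = 0 ∧ comp d p (EHom K n i) = 0

/-- The quantum integers `[k] ∈ K`: `[0] = 0`, `[1] = 1`,
`[k+1] = d·[k] − [k−1]`. -/
def qInt (d : K) : ℕ → K
  | 0 => 0
  | 1 => 1
  | k + 2 => d * qInt d (k + 1) - qInt d k


theorem exists_unique_other_fixed {A : Type} [Finite A] (σ τ : A → A)
    (hσ : Function.Involutive σ) (hσ' : ∀ u, σ u ≠ u) (hτ : Function.Involutive τ)
    (x : A) (hx : τ x = x) :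
    ∃ (O : Set A) (x' : A), x' ≠ x ∧ τ x' = x' ∧ x ∈ O ∧ x' ∈ O ∧
      (∀ u ∈ O, σ u ∈ O) ∧ (∀ u ∈ O, τ u ∈ O) ∧ (∀ u ∈ O, τ u = u → u = x ∨ u = x') ∧
      ∀ S : Set A, x ∈ S → (∀ u ∈ S, σ u ∈ S) → (∀ u ∈ S, τ u ∈ S) → O ⊆ S := by
  set s : Equiv.Perm A := hσ.toPerm with hs
  set t : Equiv.Perm A := hτ.toPerm with ht
  have hss : s⁻¹ = s := rfl
  have htt : t⁻¹ = t := rfl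
  set φ : Equiv.Perm A := t * s with hφ
  have hφinv : φ⁻¹ = s * t := by rw [hφ, mul_inv_rev, hss, htt]
  have hconj : t * φ * t⁻¹ = φ⁻¹ := by
    rw [hφinv, hφ, htt]
    ext u
    simp [hτ (σ (τ u)), hs, ht]
  have hτφ : ∀ k : ℤ, τ ((φ ^ k) x) = (φ ^ (-k)) x := by
    intro k
    have h : t * φ ^ k * t⁻¹ = φ ^ (-k) := by
      rw [← conj_zpow, hconj, inv_zpow, zpow_neg]
    rw [← h]
    change τ ((φ ^ k) x) = τ ((φ ^ k) (τ x))
    rw [hx]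
  have hσφ : ∀ k : ℤ, σ ((φ ^ k) x) = (φ ^ (-k - 1)) x := by
    intro k
    have h := hτφ (k + 1)
    rw [add_comm, zpow_add, zpow_one] at h
    have h2 : τ (τ (σ ((φ ^ k) x))) = (φ ^ (-(1 + k))) x := h
    rw [hτ] at h2
    rw [h2]; congr 2; ring
  set N : ℕ := Function.minimalPeriod (φ • ·) x with hN
  have hper : ∀ k : ℤ, (φ ^ k) x = x ↔ (N : ℤ) ∣ k := fun k =>
    MulAction.zpow_smul_eq_iff_minimalPeriod_dvd (a := φ) (b := x)
  have heq : ∀ k l : ℤ, (φ ^ k) x = (φ ^ l) x ↔ (N : ℤ) ∣ k - l := by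
    intro k l
    rw [← hper, sub_eq_neg_add, zpow_add, Equiv.Perm.mul_apply, zpow_neg,
      Equiv.Perm.inv_eq_iff_eq]
  have hNpos : 0 < N := by
    have h1 : φ ^ (orderOf φ : ℤ) = 1 := by rw [zpow_natCast, pow_orderOf_eq_one]
    have h2 := (hper (orderOf φ)).1 (by rw [h1]; rfl)
    have h3 : 0 < orderOf φ := orderOf_pos φ
    exact Nat.pos_of_dvd_of_pos (by exact_mod_cast h2) h3
  obtain ⟨M, hM⟩ : ∃ M : ℕ, N = 2 * M := by
    rcases Nat.even_or_odd' N with ⟨k, h | h⟩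
    · exact ⟨k, h⟩
    · exfalso
      apply hσ' ((φ ^ (k : ℤ)) x)
      rw [hσφ, heq]
      exact ⟨-1, by rw [h]; push_cast; ring⟩
  refine ⟨{u | ∃ k : ℤ, u = (φ ^ k) x}, (φ ^ (M : ℤ)) x, ?_, ?_, ⟨0, rfl⟩, ⟨M, rfl⟩, ?_, ?_, ?_, ?_⟩
  · intro h
    rw [hper] at h
    have := Nat.le_of_dvd (by omega) (Int.natCast_dvd_natCast.1 h)
    omega
  · rw [hτφ, heq]
    exact ⟨-1, by rw [hM]; push_cast; ring⟩
  · rintro _ ⟨k, rfl⟩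
    exact ⟨_, hσφ k⟩
  · rintro _ ⟨k, rfl⟩
    exact ⟨_, hτφ k⟩
  · rintro _ ⟨k, rfl⟩ h
    rw [hτφ, heq] at h
    obtain ⟨c, hc⟩ := h
    have hk : k = M * (-c) := by rw [hM] at hc; push_cast at hc; linarith
    rcases Int.even_or_odd' (-c) with ⟨e, he | he⟩
    · left
      rw [hper]
      exact ⟨e, by rw [hk, he, hM]; push_cast; ring⟩
    · right
      rw [heq]
      exact ⟨e, by rw [hk, he, hM]; push_cast; ring⟩
  · rintro S hxS h1 h2 _ ⟨k, rfl⟩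
    have hpos : ∀ n : ℕ, (φ ^ n) x ∈ S := by
      intro n
      induction n with
      | zero => exact hxS
      | succ n ih => rw [pow_succ', Equiv.Perm.mul_apply]; exact h2 _ (h1 _ ih)
    rcases Int.eq_nat_or_neg k with ⟨n, rfl | rfl⟩
    · simpa using hpos n
    · rw [← hτφ]; exact h2 _ (by simpa using hpos n)

/-- The position of an outer point in the stacked picture. -/
def outer {l m n : ℕ} : Fin l ⊕ Fin n → Pt l m n := Sum.map id Sum.inr

theorem conn_left {l m n : ℕ} (a : Diagram l m) (b : Diagram m n) (u : Fin l ⊕ Fin m) :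
    Conn a b (Sum.map id Sum.inl u) (Sum.map id Sum.inl (a.pair u)) :=
  .rel _ _ (.inl ⟨u, rfl, rfl⟩)

theorem conn_right {l m n : ℕ} (a : Diagram l m) (b : Diagram m n) (u : Fin m ⊕ Fin n) :
    Conn a b (Sum.inr u) (Sum.inr (b.pair u)) :=
  .rel _ _ (.inr ⟨u, rfl, rfl⟩)

theorem Conn.symm {l m n : ℕ} {a : Diagram l m} {b : Diagram m n} {x y : Pt l m n}
    (h : Conn a b x y) : Conn a b y x := Relation.EqvGen.symm _ _ h

theorem Conn.trans {l m n : ℕ} {a : Diagram l m} {b : Diagram m n} {x y z : Pt l m n}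
    (h : Conn a b x y) (h' : Conn a b y z) : Conn a b x z := Relation.EqvGen.trans _ _ _ h h'

/-- A predicate preserved by the strands of both diagrams is constant on connected components. -/
theorem Conn.iff_of_pair {l m n : ℕ} {a : Diagram l m} {b : Diagram m n} {x y : Pt l m n}
    (h : Conn a b x y) {α : Type*} (F : Pt l m n → α)
    (ha : ∀ u, F (Sum.map id Sum.inl (a.pair u)) = F (Sum.map id Sum.inl u))
    (hb : ∀ u, F (Sum.inr (b.pair u)) = F (Sum.inr u)) : F x = F y := by
  induction h with
  | rel x y h =>
    rcases h with ⟨u, rfl, rfl⟩ | ⟨u, rfl, rfl⟩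
    · exact (ha u).symm
    · exact (hb u).symm
  | refl => rfl
  | symm _ _ _ ih => exact ih.symm
  | trans _ _ _ _ _ ih ih' => exact ih.trans ih'

theorem exists_partner {l m n : ℕ} (a : Diagram l m) (b : Diagram m n) (x : Fin l ⊕ Fin n) :
    ∃ x', x' ≠ x ∧ Conn a b (outer x) (outer x') ∧
      ∀ y, Conn a b (outer x) (outer y) → y = x ∨ y = x' := by
  let σ : (Fin l ⊕ Fin m) ⊕ (Fin m ⊕ Fin n) → (Fin l ⊕ Fin m) ⊕ (Fin m ⊕ Fin n) :=
    Sum.map a.pair b.pair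
  let τ : (Fin l ⊕ Fin m) ⊕ (Fin m ⊕ Fin n) → (Fin l ⊕ Fin m) ⊕ (Fin m ⊕ Fin n) :=
    Sum.elim (Sum.elim (fun i => .inl (.inl i)) (fun j => .inr (.inl j)))
      (Sum.elim (fun j => .inl (.inr j)) (fun k => .inr (.inr k)))
  let q : (Fin l ⊕ Fin m) ⊕ (Fin m ⊕ Fin n) → Pt l m n :=
    Sum.elim (Sum.map id Sum.inl) Sum.inr
  let o : Fin l ⊕ Fin n → (Fin l ⊕ Fin m) ⊕ (Fin m ⊕ Fin n) := Sum.map Sum.inl Sum.inr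
  have hqo : ∀ y, q (o y) = outer y := by rintro (i | k) <;> rfl
  have hoinj : Function.Injective o := Sum.map_injective.2 ⟨Sum.inl_injective, Sum.inr_injective⟩
  have hτo : ∀ y, τ (o y) = o y := by rintro (i | k) <;> rfl
  have hfix : ∀ u, τ u = u → ∃ y, u = o y := by
    rintro ((i | j) | (j | k)) h
    · exact ⟨.inl i, rfl⟩
    · simp [τ] at h
    · simp [τ] at h
    · exact ⟨.inr k, rfl⟩
  have hqq : ∀ u v, q u = q v → v = u ∨ v = τ u := by
    rintro ((i | j) | (j | k)) ((i' | j') | (j' | k')) h <;>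
      simp only [q, Sum.elim_inl, Sum.elim_inr, Sum.map_inl, Sum.map_inr] at h <;>
      cases h <;> first | exact .inl rfl | exact .inr rfl
  have hqτ : ∀ u, q (τ u) = q u := by
    rintro ((i | j) | (j | k)) <;> rfl
  have hσi : Function.Involutive σ := by
    rintro (u | u)
    · simp [σ, a.involutive u]
    · simp [σ, b.involutive u]
  have hσf : ∀ u, σ u ≠ u := by
    rintro (u | u)
    · simp [σ, a.fixedPointFree u]
    · simp [σ, b.fixedPointFree u]
  have hτi : Function.Involutive τ := by
    rintro ((i | j) | (j | k)) <;> rfl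
  obtain ⟨O, x', hne, hτx', hxO, hx'O, hOσ, hOτ, hOfix, hOmin⟩ :=
    exists_unique_other_fixed σ τ hσi hσf hτi (o x) (hτo x)
  obtain ⟨y', rfl⟩ := hfix x' hτx'
  refine ⟨y', fun h => hne (by rw [h]), ?_, ?_⟩
  · have := hOmin {u | Conn a b (outer x) (q u)} (by
        change Conn a b _ _
        rw [hqo]; exact .refl _)
      (by
        rintro (u | u) hu
        · exact Conn.trans hu (conn_left a b u)
        · exact Conn.trans hu (conn_right a b u))
      (by
        intro u hu
        change Conn a b _ _
        rw [hqτ]; exact hu) hx'O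
    rw [← hqo y']
    exact this
  · intro y hy
    have hOσ' : ∀ u, σ u ∈ O ↔ u ∈ O := fun u =>
      ⟨fun h => by simpa [hσi u] using hOσ _ h, hOσ u⟩
    have hmem : ∀ u, (∃ v ∈ O, q v = q u) ↔ u ∈ O := by
      intro u
      refine ⟨?_, fun h => ⟨u, h, rfl⟩⟩
      rintro ⟨v, hv, h⟩
      rcases hqq v u h with rfl | rfl
      · exact hv
      · exact hOτ _ hv
    have key := hy.iff_of_pair (fun z => ∃ v ∈ O, q v = z)
      (fun u => by
        have := (hmem (σ (.inl u))).trans ((hOσ' _).trans (hmem (.inl u)).symm)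
        exact propext this)
      (fun u => by
        have := (hmem (σ (.inr u))).trans ((hOσ' _).trans (hmem (.inr u)).symm)
        exact propext this)
    simp only [← hqo, hmem] at key
    have hyO : o y ∈ O := by rw [← key]; exact hxO
    rcases hOfix _ hyO (hτo y) with h | h
    · exact .inl (hoinj h)
    · exact .inr (hoinj h)

theorem bIdx_injective (m n : ℕ) : Function.Injective (bIdx m n) := by
  rintro (i | i) (j | j) h <;> simp only [bIdx] at h
  · rw [Fin.ext h]
  · omega
  · omega
  · have : i = j := by ext; omega
    rw [this]

/-- The parity of the number of points of `Q` preceding `u` in the boundary order. -/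
noncomputable def parity {m n : ℕ} (Q : Fin m ⊕ Fin n → Prop) (u : Fin m ⊕ Fin n) : ZMod 2 :=
  ∑ v, if Q v ∧ bIdx m n v < bIdx m n u then 1 else 0

theorem parity_pair {m n : ℕ} (D : Diagram m n) (Q : Fin m ⊕ Fin n → Prop)
    (hQ : ∀ v, Q (D.pair v) ↔ Q v) (u : Fin m ⊕ Fin n) (hu : ¬ Q u) :
    parity Q (D.pair u) = parity Q u := by
  suffices h : parity Q (D.pair u) + parity Q u = 0 by
    rw [← sub_eq_zero, ← h, CharTwo.sub_eq_add]
  rw [parity, parity, ← Finset.sum_add_distrib]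
  refine Finset.sum_involution (fun v _ => D.pair v) ?_ (fun v _ _ => D.fixedPointFree v)
    (fun _ _ => Finset.mem_univ _) (fun v _ => D.involutive v)
  intro v _
  simp only [hQ]
  by_cases hv : Q v
  · have hne : ∀ w, Q w → bIdx m n w ≠ bIdx m n u := fun w hw h =>
      hu (bIdx_injective _ _ h ▸ hw)
    have hne' : ∀ w, Q w → bIdx m n w ≠ bIdx m n (D.pair u) := fun w hw h =>
      hu (by rw [← hQ]; exact bIdx_injective _ _ h ▸ hw)
    have e1 := hne v hv
    have e2 := hne _ ((hQ v).2 hv)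
    have e3 := hne' v hv
    have e4 := hne' _ ((hQ v).2 hv)
    have n1 := D.noncrossing u v
    have n2 := D.noncrossing v u
    have n3 := D.noncrossing (D.pair u) v
    have n4 := D.noncrossing u (D.pair v)
    have n5 := D.noncrossing (D.pair u) (D.pair v)
    have n6 := D.noncrossing (D.pair v) u
    have n7 := D.noncrossing v (D.pair u)
    have n8 := D.noncrossing (D.pair v) (D.pair u)
    simp only [D.involutive u, D.involutive v] at n1 n2 n3 n4 n5 n6 n7 n8
    simp only [hv, true_and]
    have h2 : (1 : ZMod 2) + 1 = 0 := rfl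
    split_ifs <;> first | omega | simp [h2]
  · simp [hv]

theorem parity_inl {m n : ℕ} (Q : Fin m ⊕ Fin n → Prop) (i : Fin m) :
    parity Q (.inl i) = ∑ i' : Fin m, if Q (.inl i') ∧ i' < i then 1 else 0 := by
  rw [parity, Fintype.sum_sum_type]
  have : ∀ j : Fin n, ¬ (m + (n - 1 - (j : ℕ)) < i) := fun j => by omega
  simp [bIdx, this]

theorem parity_inr {m n : ℕ} (Q : Fin m ⊕ Fin n → Prop) (j : Fin n) :
    parity Q (.inr j) = (∑ i : Fin m, if Q (.inl i) then 1 else 0) +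
      ∑ j' : Fin n, if Q (.inr j') ∧ j < j' then 1 else 0 := by
  rw [parity, Fintype.sum_sum_type]
  have h1 : ∀ i : Fin m, (i : ℕ) < m + (n - 1 - (j : ℕ)) := fun i => by omega
  have h2 : ∀ j' : Fin n, (m + (n - 1 - (j' : ℕ)) < m + (n - 1 - (j : ℕ))) ↔ j < j' := fun j' => by
    rw [Fin.lt_def]; omega
  simp only [bIdx, h1, h2, and_true]

theorem parity_outer_eq {l m n : ℕ} {a : Diagram l m} {b : Diagram m n} (P : Pt l m n → Prop)
    (hP : ∀ z w, Conn a b z w → (P z ↔ P w)) {x y : Fin l ⊕ Fin n}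
    (h : Conn a b (outer x) (outer y)) (hx : ¬ P (outer x)) :
    parity (fun v => P (outer v)) x = parity (fun v => P (outer v)) y := by
  let T : ZMod 2 := ∑ i : Fin l, if P (.inl i) then 1 else 0
  let M : ZMod 2 := ∑ j : Fin m, if P (.inr (.inl j)) then 1 else 0
  let κ : Pt l m n → ZMod 2 := Sum.elim (fun i => parity (fun v => P (outer v)) (.inl i))
    (Sum.elim (fun j => parity (fun v => P (Sum.map id Sum.inl v)) (.inr j))
      (fun k => parity (fun v => P (outer v)) (.inr k)))
  have hout : ∀ v, κ (outer v) = parity (fun v => P (outer v)) v := by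
    rintro (i | k) <;> rfl
  have hA : ∀ u, κ (Sum.map id Sum.inl u) = parity (fun v => P (Sum.map id Sum.inl v)) u := by
    rintro (i | j)
    · change parity _ _ = parity _ _
      rw [parity_inl, parity_inl]; rfl
    · rfl
  have hB : ∀ u, ¬ P (.inr u) → κ (.inr u) = parity (fun v => P (.inr v)) u + (T + M) := by
    rintro (j | k) hu
    · change parity _ _ = _
      rw [parity_inl, parity_inr]
      change T + (∑ j' : Fin m, if P (.inr (.inl j')) ∧ j < j' then (1 : ZMod 2) else 0) =
        (∑ j' : Fin m, if P (.inr (.inl j')) ∧ j' < j then (1 : ZMod 2) else 0) + (T + M)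
      have : ∀ j' : Fin m, (if P (.inr (.inl j')) then (1 : ZMod 2) else 0) =
          (if P (.inr (.inl j')) ∧ j' < j then 1 else 0) +
          (if P (.inr (.inl j')) ∧ j < j' then 1 else 0) := by
        intro j'
        rcases lt_trichotomy j' j with h | rfl | h
        · simp [h, h.not_gt]
        · simp [hu]
        · simp [h, h.not_gt]
      simp only [M, this, Finset.sum_add_distrib]
      generalize (∑ j' : Fin m, if P (.inr (.inl j')) ∧ j' < j then (1 : ZMod 2) else 0) = s
      have h2 : s + s = 0 := CharTwo.add_self_eq_zero s
      linear_combination -h2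
    · change parity _ _ = _
      rw [parity_inr, parity_inr]
      change T + _ = (M + _) + (T + M)
      have h2 : M + M = 0 := CharTwo.add_self_eq_zero M
      change T + (∑ j' : Fin n, if P (.inr (.inr j')) ∧ k < j' then (1 : ZMod 2) else 0) = _
      linear_combination -h2
  have key := h.iff_of_pair (fun z => if P z then 0 else κ z)
    (fun u => by
      have hu := hP _ _ (conn_left a b u)
      by_cases h : P (Sum.map id Sum.inl u)
      · simp only [h, ← hu, if_true]
      · simp only [h, ← hu, if_false]
        rw [hA, hA]
        exact parity_pair a _ (fun v => (hP _ _ (conn_left a b v)).symm) u h)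
    (fun u => by
      have hu := hP _ _ (conn_right a b u)
      by_cases h : P (Sum.inr u)
      · simp only [h, ← hu, if_true]
      · simp only [h, ← hu, if_false]
        rw [hB u h, hB _ (by rwa [← hu])]
        rw [parity_pair b _ (fun v => (hP _ _ (conn_right a b v)).symm) u h])
  have hy : ¬ P (outer y) := by rwa [← hP _ _ h]
  simpa only [hx, hy, if_false, hout] using key

theorem exists_composite {l m n : ℕ} (a : Diagram l m) (b : Diagram m n) :
    ∃ c : Diagram l n, ∀ x y, Conn a b (outer x) (outer y) ↔ y = x ∨ y = c.pair x := by
  choose r hne hconn huniq using exists_partner a b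
  have hiff : ∀ x y, Conn a b (outer x) (outer y) ↔ y = x ∨ y = r x := fun x y =>
    ⟨huniq x y, by rintro (rfl | rfl); exacts [.refl _, hconn x]⟩
  have hinv : Function.Involutive r := fun x => by
    rcases (hiff (r x) x).1 (hconn x).symm with h | h
    · exact absurd h.symm (hne x)
    · exact h.symm
  refine ⟨⟨r, hinv, hne, ?_⟩, hiff⟩
  rintro x y ⟨h1, h2, h3⟩
  have hyP : ¬ Conn a b (outer x) (outer y) := by
    rw [hiff]
    rintro (rfl | rfl) <;> omega
  have hpar := parity_outer_eq (fun z => Conn a b (outer x) z)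
    (fun z w h => ⟨fun h' => h'.trans h, fun h' => h'.trans h.symm⟩) (hconn y) hyP
  have hcount : ∀ u, parity (fun v => Conn a b (outer x) (outer v)) u =
      (if bIdx l n x < bIdx l n u then 1 else 0) +
        (if bIdx l n (r x) < bIdx l n u then 1 else 0) := by
    intro u
    rw [parity]
    have : ∀ v, (if Conn a b (outer x) (outer v) ∧ bIdx l n v < bIdx l n u
        then (1 : ZMod 2) else 0) =
        (if v = x then (if bIdx l n x < bIdx l n u then 1 else 0) else 0) +
        (if v = r x then (if bIdx l n (r x) < bIdx l n u then 1 else 0) else 0) := by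
      intro v
      rw [hiff]
      by_cases hv : v = x
      · subst hv; simp [(hne v).symm]
      · by_cases hv' : v = r x
        · subst hv'; simp [hne x]
        · simp [hv, hv']
    simp [this, Finset.sum_add_distrib]
  rw [hcount, hcount] at hpar
  simp only [h1, h3, h2.not_gt, h1.trans (h2.trans h3), if_true, if_false] at hpar
  revert hpar
  decide

/-- The two-colourings of the outer points which are constant on the strands of a diagram. -/
def Fits {m n : ℕ} (D : Diagram m n) (i : Fin m → Bool) (j : Fin n → Bool) : Prop :=
  ∀ x, Sum.elim i j (D.pair x) = Sum.elim i j x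

/-- The matrix of a diagram acting on two-colourings: the Brauer representation with loop
parameter `2`. -/
noncomputable def mat {m n : ℕ} (D : Diagram m n) :
    Matrix (Fin m → Bool) (Fin n → Bool) ℕ :=
  fun i j => if Fits D i j then 1 else 0

theorem diagram_ext {m n : ℕ} {a b : Diagram m n} (h : ∀ x, a.pair x = b.pair x) : a = b := by
  cases a; cases b
  simpa [funext_iff] using h

theorem eq_of_pow_smul_mat_eq {m n k k' : ℕ} {c c' : Diagram m n}
    (h : 2 ^ k • mat c = 2 ^ k' • mat c') : k = k' ∧ c = c' := by
  have h1 := congrFun (congrFun h fun _ => true) fun _ => true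
  have hfit : ∀ D : Diagram m n, Fits D (fun _ => true) fun _ => true := by
    rintro D (x | x) <;> rcases D.pair _ with y | y <;> rfl
  simp only [Matrix.smul_apply, mat, hfit, if_true, smul_eq_mul, mul_one] at h1
  refine ⟨Nat.pow_right_injective le_rfl h1, diagram_ext fun x => ?_⟩
  let g : Fin m ⊕ Fin n → Bool := fun y => decide (y = x ∨ y = c.pair x)
  have hg : Sum.elim (g ∘ Sum.inl) (g ∘ Sum.inr) = g := Sum.elim_comp_inl_inr g
  have h2 := congrFun (congrFun h (g ∘ Sum.inl)) (g ∘ Sum.inr)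
  have hc : Fits c (g ∘ Sum.inl) (g ∘ Sum.inr) := by
    intro y
    rw [hg]
    have e1 : c.pair y = x ↔ y = c.pair x :=
      ⟨fun e => by rw [← e, c.involutive], fun e => by rw [e, c.involutive]⟩
    have e2 : c.pair y = c.pair x ↔ y = x := c.involutive.injective.eq_iff
    simp only [g, e1, e2, or_comm]
  have hc' : Fits c' (g ∘ Sum.inl) (g ∘ Sum.inr) := by
    by_contra hn
    simp [mat, hc, hn] at h2
  have h3 := hc' x
  rw [hg] at h3
  have h4 : c'.pair x = x ∨ c'.pair x = c.pair x := by simpa [g] using h3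
  exact (h4.resolve_left (c'.fixedPointFree x)).symm

theorem sum_mat_diag {n : ℕ} (p : Diagram n n) : ∑ i, mat p i i = 2 ^ trLoops p := by
  let e : {i : Fin n → Bool // Fits p i i} ≃
      (Quotient (Relation.EqvGen.setoid (closeStep p)) → Bool) :=
    { toFun := fun i => Quotient.lift (Sum.elim i.1 i.1) (by
        intro x y h
        induction h with
        | rel x y h =>
          rcases h with rfl | rfl
          · exact (i.2 x).symm
          · rcases x with x | x <;> rfl
        | refl => rfl
        | symm _ _ _ ih => exact ih.symm
        | trans _ _ _ _ _ ih ih' => exact ih.trans ih')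
      invFun := fun g => ⟨fun k => g (Quotient.mk _ (.inl k)), by
        have hg : ∀ x, Sum.elim (fun k => g (Quotient.mk _ (.inl k)))
            (fun k => g (Quotient.mk _ (.inl k))) x =
            g (Quotient.mk (Relation.EqvGen.setoid (closeStep p)) x) := by
          rintro (x | x)
          · rfl
          · exact congrArg g (Quotient.sound (.rel _ _ (.inr rfl)))
        intro x
        rw [hg, hg]
        exact congrArg g (Quotient.sound (.symm _ _ (.rel _ _ (.inl rfl))))⟩
      left_inv := fun i => rfl
      right_inv := fun g => by
        funext x
        induction x using Quotient.inductionOn with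
        | h x =>
          rcases x with x | x
          · rfl
          · exact congrArg g (Quotient.sound (.rel _ _ (.inr rfl))) }
  have h1 : ∑ i, mat p i i = Nat.card {i : Fin n → Bool // Fits p i i} := by
    simp [mat, Nat.card_eq_fintype_card, Fintype.card_subtype]
  rw [h1, Nat.card_congr e, Nat.card_fun, trLoops]
  simp

/-- The colouring of the stacked picture with the given colours in the three layers. -/
def colour {l m n : ℕ} (i : Fin l → Bool) (z : Fin m → Bool) (j : Fin n → Bool) :
    Pt l m n → Bool := Sum.elim i (Sum.elim z j)

theorem colour_left {l m n : ℕ} (i : Fin l → Bool) (z : Fin m → Bool) (j : Fin n → Bool)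
    (u : Fin l ⊕ Fin m) : colour i z j (Sum.map id Sum.inl u) = Sum.elim i z u := by
  rcases u with u | u <;> rfl

theorem colour_outer {l m n : ℕ} (i : Fin l → Bool) (z : Fin m → Bool) (j : Fin n → Bool)
    (u : Fin l ⊕ Fin n) : colour i z j (outer u) = Sum.elim i j u := by
  rcases u with u | u <;> rfl

theorem Conn.colour_eq {l m n : ℕ} {a : Diagram l m} {b : Diagram m n} {x y : Pt l m n}
    (h : Conn a b x y) {i : Fin l → Bool} {z : Fin m → Bool} {j : Fin n → Bool}
    (ha : Fits a i z) (hb : Fits b z j) : colour i z j x = colour i z j y :=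
  h.iff_of_pair _ (fun u => by rw [colour_left, colour_left]; exact ha u) hb

theorem card_middle_colourings {l m n : ℕ} {a : Diagram l m} {b : Diagram m n}
    {c : Diagram l n} (hc : ∀ x y, Conn a b (outer x) (outer y) ↔ y = x ∨ y = c.pair x)
    {i : Fin l → Bool} {j : Fin n → Bool} (hij : Fits c i j) :
    Nat.card {z : Fin m → Bool // Fits a i z ∧ Fits b z j} = 2 ^ numLoops a b := by
  let s : Setoid (ClosedMid a b) := ⟨fun x y => Conn a b x.1 y.1,
    ⟨fun _ => .refl _, fun h => h.symm, fun h h' => h.trans h'⟩⟩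
  let r : {z : Fin m → Bool // Fits a i z ∧ Fits b z j} → (Quotient s → Bool) := fun z =>
    Quotient.lift (fun x => colour i z.1 j x.1) fun x y h => Conn.colour_eq h z.2.1 z.2.2
  have hreach : ∀ k : Fin m, (.inr (.inl k)) ∉ ClosedMid a b →
      ∃ y, Conn a b (.inr (.inl k)) (outer y) := by
    intro k hk
    have hk' : ¬ ∀ y, Conn a b (.inr (.inl k)) y → ∃ j : Fin m, y = .inr (.inl j) :=
      fun h => hk ⟨⟨k, rfl⟩, h⟩
    push Not at hk'
    obtain ⟨y, hy, hne⟩ := hk'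
    rcases y with y | y | y
    · exact ⟨.inl y, hy⟩
    · exact absurd rfl (hne y)
    · exact ⟨.inr y, hy⟩
  have hbij : Function.Bijective r := by
    constructor
    · intro z z' h
      apply Subtype.ext
      funext k
      by_cases hk : (.inr (.inl k)) ∈ ClosedMid a b
      · exact congrFun h (Quotient.mk s ⟨_, hk⟩)
      · obtain ⟨y, hy⟩ := hreach k hk
        have h1 := hy.colour_eq z.2.1 z.2.2
        have h2 := hy.colour_eq z'.2.1 z'.2.2
        rw [colour_outer] at h1 h2
        exact h1.trans h2.symm
    · intro g
      let F : Pt l m n → Bool := fun x =>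
        if h : x ∈ ClosedMid a b then g (Quotient.mk s ⟨x, h⟩)
        else if h' : ∃ y, Conn a b x (outer y) then Sum.elim i j h'.choose else false
      have hmid : ∀ y, outer y ∉ ClosedMid a b := by
        rintro (y | y) ⟨⟨k, hk⟩, -⟩ <;> simp [outer] at hk
      have houter : ∀ x y, Conn a b (outer x) (outer y) → Sum.elim i j x = Sum.elim i j y := by
        intro x y h
        rcases (hc x y).1 h with rfl | rfl
        · rfl
        · exact (hij x).symm
      have hclosed : ∀ x y, Conn a b x y → x ∈ ClosedMid a b → y ∈ ClosedMid a b :=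
        fun x y h hx => ⟨hx.2 y h, fun w hw => hx.2 w (h.trans hw)⟩
      have hF : ∀ x y, Conn a b x y → F x = F y := by
        intro x y h
        by_cases hx : x ∈ ClosedMid a b
        · have hy := hclosed x y h hx
          simp only [F, hx, hy, dif_pos]
          exact congrArg g (Quotient.sound h)
        · have hy : y ∉ ClosedMid a b := fun hy => hx (hclosed y x h.symm hy)
          simp only [F, hx, hy, dif_neg, not_false_eq_true]
          by_cases hx' : ∃ w, Conn a b x (outer w)
          · have hy' : ∃ w, Conn a b y (outer w) := hx'.imp fun w hw => h.symm.trans hw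
            rw [dif_pos hx', dif_pos hy']
            exact houter _ _ ((hx'.choose_spec.symm.trans h).trans hy'.choose_spec)
          · have hy' : ¬ ∃ w, Conn a b y (outer w) := fun hy' =>
              hx' (hy'.imp fun w hw => h.trans hw)
            rw [dif_neg hx', dif_neg hy']
      have hFo : ∀ y, F (outer y) = Sum.elim i j y := by
        intro y
        have h' : ∃ w, Conn a b (outer y) (outer w) := ⟨y, .refl _⟩
        simp only [F, hmid, dif_neg, not_false_eq_true]
        rw [dif_pos h']
        exact (houter _ _ h'.choose_spec).symm
      have hcol : F = colour i (fun k => F (.inr (.inl k))) j := by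
        funext x
        rcases x with x | x | x
        · exact hFo (.inl x)
        · rfl
        · exact hFo (.inr x)
      refine ⟨⟨fun k => F (.inr (.inl k)), ?_, ?_⟩, ?_⟩
      · intro u
        rw [← colour_left _ _ j, ← colour_left _ _ j, ← hcol]
        exact (hF _ _ (conn_left a b u)).symm
      · intro u
        change colour i _ j (.inr _) = colour i _ j (.inr _)
        rw [← hcol]
        exact (hF _ _ (conn_right a b u)).symm
      · funext x
        induction x using Quotient.inductionOn with
        | h x =>
          change colour i _ j x.1 = _
          rw [← hcol]
          simp only [F, x.2, dif_pos]
  rw [Nat.card_eq_of_bijective r hbij, Nat.card_fun, numLoops]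
  simp [s]

theorem exists_compD_eq {l m n : ℕ} (a : Diagram l m) (b : Diagram m n) :
    ∃ (k : ℕ) (c : Diagram l n), (∀ d : K, compD d b a = d ^ k • single c) ∧
      mat a * mat b = 2 ^ k • mat c := by
  obtain ⟨c, hc⟩ := exists_composite a b
  refine ⟨numLoops a b, c, fun d => ?_, ?_⟩
  · funext c'
    have : (∀ x : Fin l ⊕ Fin n, Conn a b (Sum.map id Sum.inr x)
        (Sum.map id Sum.inr (c'.pair x))) ↔ c' = c := by
      refine ⟨fun h => diagram_ext fun x => ?_, ?_⟩
      · exact ((hc x _).1 (h x)).resolve_left (c'.fixedPointFree x)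
      · rintro rfl x
        exact (hc x _).2 (.inr rfl)
    rw [compD, if_congr this rfl rfl]
    simp [single]
  · funext i j
    have h1 : (mat a * mat b) i j =
        Nat.card {z : Fin m → Bool // Fits a i z ∧ Fits b z j} := by
      simp [Matrix.mul_apply, mat, Nat.card_eq_fintype_card, Fintype.card_subtype, ← ite_and,
        and_comm]
    rw [h1, Matrix.smul_apply, mat]
    by_cases hij : Fits c i j
    · rw [card_middle_colourings hc hij]
      simp [hij]
    · have : IsEmpty {z : Fin m → Bool // Fits a i z ∧ Fits b z j} := by
        refine ⟨fun z => hij fun x => ?_⟩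
        have h := ((hc x _).2 (.inr rfl)).colour_eq z.2.1 z.2.2
        rw [colour_outer, colour_outer] at h
        exact h.symm
      simp [hij]

/-- The diagram obtained by horizontal juxtaposition. -/
def juxtapose {m n m' n' : ℕ} (a : Diagram m n) (b : Diagram m' n') :
    Diagram (m + m') (n + n') where
  pair := tensorPair a b
  involutive x := by
    have : ∀ y, Sum.map a.pair b.pair (Sum.map a.pair b.pair y) = y := by
      rintro (y | y)
      · simp [a.involutive y]
      · simp [b.involutive y]
    simp [tensorPair, this]
  fixedPointFree x := by
    have : ∀ y, Sum.map a.pair b.pair y ≠ y := by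
      rintro (y | y)
      · simp [a.fixedPointFree y]
      · simp [b.fixedPointFree y]
    intro h
    rw [tensorPair, Equiv.symm_apply_eq] at h
    exact this _ h
  noncrossing x y := by
    obtain ⟨u, rfl⟩ := (tEquiv m n m' n').symm.surjective x
    obtain ⟨v, rfl⟩ := (tEquiv m n m' n').symm.surjective y
    have hl : ∀ w, bIdx (m + m') (n + n') ((tEquiv m n m' n').symm (.inl w)) =
        bIdx m n w + if bIdx m n w < m then 0 else m' + n' := by
      rintro (w | w)
      · simp [tEquiv, bIdx]
      · simp [tEquiv, bIdx]; omega
    have hr : ∀ w, bIdx (m + m') (n + n') ((tEquiv m n m' n').symm (.inr w)) =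
        m + bIdx m' n' w := by
      rintro (w | w)
      · simp [tEquiv, bIdx]
      · simp [tEquiv, bIdx]; omega
    have hb : ∀ w, bIdx m' n' w < m' + n' := by
      rintro (w | w) <;> simp only [bIdx] <;> omega
    rcases u with u | u <;> rcases v with v | v <;>
      simp only [tensorPair, Equiv.apply_symm_apply, Sum.map_inl, Sum.map_inr, hl, hr]
    · have := a.noncrossing u v
      split_ifs <;> omega
    · have h1 := hb v
      have h2 := hb (b.pair v)
      split_ifs <;> omega
    · have h1 := hb u
      have h2 := hb (b.pair u)
      split_ifs <;> omega
    · have := b.noncrossing u v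
      omega

theorem tensorD_eq {m n m' n' : ℕ} (a : Diagram m n) (b : Diagram m' n') :
    (tensorD a b : Hom K _ _) = single (juxtapose a b) := by
  funext c
  have : c.pair = tensorPair a b ↔ c = juxtapose a b :=
    ⟨fun h => diagram_ext fun x => congrFun h x, fun h => by rw [h]; rfl⟩
  simp [tensorD, single, this]

/-- The Kronecker product of matrices indexed by two-colourings. -/
def kron {m n m' n' : ℕ} (F : Matrix (Fin m → Bool) (Fin n → Bool) ℕ)
    (G : Matrix (Fin m' → Bool) (Fin n' → Bool) ℕ) :
    Matrix (Fin (m + m') → Bool) (Fin (n + n') → Bool) ℕ :=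
  fun i j => F (fun k => i (Fin.castAdd _ k)) (fun k => j (Fin.castAdd _ k)) *
    G (fun k => i (Fin.natAdd _ k)) (fun k => j (Fin.natAdd _ k))

theorem kron_apply {m n m' n' : ℕ} (F : Matrix (Fin m → Bool) (Fin n → Bool) ℕ)
    (G : Matrix (Fin m' → Bool) (Fin n' → Bool) ℕ) (i : Fin (m + m') → Bool)
    (j : Fin (n + n') → Bool) :
    kron F G i j = F (fun k => i (Fin.castAdd _ k)) (fun k => j (Fin.castAdd _ k)) *
      G (fun k => i (Fin.natAdd _ k)) (fun k => j (Fin.natAdd _ k)) := rfl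

theorem mat_juxtapose {m n m' n' : ℕ} (a : Diagram m n) (b : Diagram m' n') :
    mat (juxtapose a b) = kron (mat a) (mat b) := by
  funext i j
  have hl : ∀ w, Sum.elim i j ((tEquiv m n m' n').symm (.inl w)) =
      Sum.elim (fun k => i (Fin.castAdd _ k)) (fun k => j (Fin.castAdd _ k)) w := by
    rintro (w | w) <;> simp [tEquiv]
  have hr : ∀ w, Sum.elim i j ((tEquiv m n m' n').symm (.inr w)) =
      Sum.elim (fun k => i (Fin.natAdd _ k)) (fun k => j (Fin.natAdd _ k)) w := by
    rintro (w | w) <;> simp [tEquiv]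
  have : Fits (juxtapose a b) i j ↔
      Fits a (fun k => i (Fin.castAdd _ k)) (fun k => j (Fin.castAdd _ k)) ∧
      Fits b (fun k => i (Fin.natAdd _ k)) (fun k => j (Fin.natAdd _ k)) := by
    rw [Fits, ← (tEquiv m n m' n').symm.forall_congr_right, Sum.forall]
    simp only [juxtapose, tensorPair, Equiv.apply_symm_apply, Sum.map_inl, Sum.map_inr, hl, hr]
    rfl
  simp only [mat, kron, this, ite_and, mul_ite, mul_one, mul_zero]
  split_ifs <;> rfl

/-- The identity matrix on two-colourings of `n` points. -/
def idMat (n : ℕ) : Matrix (Fin n → Bool) (Fin n → Bool) ℕ := fun i j => if i = j then 1 else 0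

/-- The matrix of the cap on two-colourings. -/
def capMat : Matrix (Fin 0 → Bool) (Fin 2 → Bool) ℕ := fun _ j => if j 0 = j 1 then 1 else 0

/-- The matrix of the cup on two-colourings. -/
def cupMat : Matrix (Fin 2 → Bool) (Fin 0 → Bool) ℕ := fun i _ => if i 0 = i 1 then 1 else 0

theorem mat_idD (n : ℕ) : mat (idD n) = idMat n := by
  funext i j
  have : Fits (idD n) i j ↔ i = j := by
    simp only [Fits, idD, Sum.forall, Sum.elim_inl, Sum.elim_inr, funext_iff]
    exact ⟨fun h => h.2, fun h => ⟨fun a => (h a).symm, h⟩⟩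
  simp [mat, idMat, this]

theorem mat_capD : mat capD = capMat := by
  funext i j
  have : Fits capD i j ↔ j 0 = j 1 := by
    simp only [Fits, capD, Sum.forall, Sum.elim_inl, Sum.elim_inr, IsEmpty.forall_iff, true_and,
      Fin.forall_fin_two]
    exact ⟨fun h => h.1.symm, fun h => ⟨h.symm, h⟩⟩
  simp [mat, capMat, this]

theorem mat_cupD : mat cupD = cupMat := by
  funext i j
  have : Fits cupD i j ↔ i 0 = i 1 := by
    simp only [Fits, cupD, Sum.forall, Sum.elim_inl, Sum.elim_inr, IsEmpty.forall_iff, and_true,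
      Fin.forall_fin_two]
    exact ⟨fun h => h.1.symm, fun h => ⟨h.symm, h⟩⟩
  simp [mat, cupMat, this]

theorem comp_add_left (d : K) {l m n : ℕ} (b b' : Hom K m n) (a : Hom K l m) :
    comp d (b + b') a = comp d b a + comp d b' a := by
  funext c
  simp [comp, add_mul, Finset.sum_add_distrib]

theorem comp_smul_left (d : K) {l m n : ℕ} (s : K) (b : Hom K m n) (a : Hom K l m) :
    comp d (s • b) a = s • comp d b a := by
  funext c
  simp [comp, Finset.mul_sum, mul_assoc]

theorem comp_add_right (d : K) {l m n : ℕ} (b : Hom K m n) (a a' : Hom K l m) :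
    comp d b (a + a') = comp d b a + comp d b a' := by
  funext c
  simp [comp, mul_add, add_mul, Finset.sum_add_distrib]

theorem comp_smul_right (d : K) {l m n : ℕ} (s : K) (b : Hom K m n) (a : Hom K l m) :
    comp d b (s • a) = s • comp d b a := by
  funext c
  simp [comp, Finset.mul_sum, mul_assoc, mul_left_comm]

theorem tensor_add_left {m n m' n' : ℕ} (x x' : Hom K m n) (y : Hom K m' n') :
    tensor (x + x') y = tensor x y + tensor x' y := by
  funext c
  simp [tensor, add_mul, Finset.sum_add_distrib]

theorem tensor_smul_left {m n m' n' : ℕ} (s : K) (x : Hom K m n) (y : Hom K m' n') :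
    tensor (s • x) y = s • tensor x y := by
  funext c
  simp [tensor, Finset.mul_sum, mul_assoc]

theorem tensor_smul_right {m n m' n' : ℕ} (s : K) (x : Hom K m n) (y : Hom K m' n') :
    tensor x (s • y) = s • tensor x y := by
  funext c
  simp [tensor, Finset.mul_sum, mul_assoc, mul_left_comm]

theorem eps_add (d : K) (n : ℕ) (a a' : Hom K (n + 1) (n + 1)) :
    eps d n (a + a') = eps d n a + eps d n a' := by
  rw [eps, tensor_add_left]
  exact (congrArg _ (comp_add_left d _ _ _)).trans (comp_add_right d _ _ _)

theorem eps_smul (d : K) (n : ℕ) (s : K) (a : Hom K (n + 1) (n + 1)) :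
    eps d n (s • a) = s • eps d n a := by
  rw [eps, tensor_smul_left]
  exact (congrArg _ (comp_smul_left d _ _ _)).trans (comp_smul_right d _ _ _)

theorem Tr_add (d : K) {n : ℕ} (x y : Hom K n n) : Tr d (x + y) = Tr d x + Tr d y := by
  simp [Tr, add_mul, Finset.sum_add_distrib]

theorem Tr_smul (d : K) {n : ℕ} (s : K) (x : Hom K n n) : Tr d (s • x) = s * Tr d x := by
  simp [Tr, Finset.mul_sum, mul_assoc]

theorem eq_of_single {m n : ℕ} {V : Type} [AddCommGroup V] [Module K V] {A B : Hom K m n → V}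
    (hA : IsLinearMap K A) (hB : IsLinearMap K B) (h : ∀ c, A (single c) = B (single c))
    (x : Hom K m n) : A x = B x := by
  have hx : x = ∑ c, x c • single c := by
    funext c
    simp [single]
  have hsum : ∀ {A : Hom K m n → V}, IsLinearMap K A → A x = ∑ c, x c • A (single c) := by
    intro A hA
    have := map_sum hA.mk' (fun c => x c • (single c : Hom K m n)) Finset.univ
    rw [← hx] at this
    simpa [IsLinearMap.mk'_apply, hA.map_smul] using this
  rw [hsum hA, hsum hB]
  simp only [h]

theorem comp_single (d : K) {l m n : ℕ} (b : Diagram m n) (a : Diagram l m) :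
    comp d (single b) (single a) = compD d b a := by
  funext c
  simp [comp, single]

theorem tensor_single {m n m' n' : ℕ} (a : Diagram m n) (b : Diagram m' n') :
    (tensor (single a) (single b) : Hom K _ _) = single (juxtapose a b) := by
  rw [← tensorD_eq]
  funext c
  simp [tensor, single]

/-- `X` is a scaled diagram `d ^ k • c` whose specialisation at loop parameter `2` acts on
two-colourings by the matrix `F`. -/
def Represents (d : K) {m n : ℕ} (X : Hom K m n)
    (F : Matrix (Fin m → Bool) (Fin n → Bool) ℕ) : Prop :=
  ∃ (k : ℕ) (c : Diagram m n), X = d ^ k • single c ∧ F = 2 ^ k • mat c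

theorem represents_single (d : K) {m n : ℕ} (c : Diagram m n) :
    Represents d (single c) (mat c) := ⟨0, c, by simp, by simp⟩

theorem Represents.unique {d : K} {m n : ℕ} {X Y : Hom K m n}
    {F G : Matrix (Fin m → Bool) (Fin n → Bool) ℕ} (hX : Represents d X F)
    (hY : Represents d Y G) (h : F = G) : X = Y := by
  obtain ⟨k, c, rfl, rfl⟩ := hX
  obtain ⟨k', c', rfl, rfl⟩ := hY
  obtain ⟨rfl, rfl⟩ := eq_of_pow_smul_mat_eq h
  rfl

theorem Represents.comp {d : K} {l m n : ℕ} {X : Hom K l m} {Y : Hom K m n}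
    {F : Matrix (Fin l → Bool) (Fin m → Bool) ℕ} {G : Matrix (Fin m → Bool) (Fin n → Bool) ℕ}
    (hY : Represents d Y G) (hX : Represents d X F) :
    Represents d (TL.comp d Y X) (F * G) := by
  obtain ⟨k, a, rfl, rfl⟩ := hX
  obtain ⟨k', b, rfl, rfl⟩ := hY
  obtain ⟨r, c, h1, h2⟩ := exists_compD_eq (K := K) a b
  refine ⟨k + k' + r, c, ?_, ?_⟩
  · rw [comp_smul_left, comp_smul_right, comp_single, h1, smul_smul, smul_smul]
    congr 1; ring
  · rw [Matrix.smul_mul, Matrix.mul_smul, h2, smul_smul, smul_smul]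
    congr 1; ring

theorem Represents.tensor {d : K} {m n m' n' : ℕ} {X : Hom K m n} {Y : Hom K m' n'}
    {F : Matrix (Fin m → Bool) (Fin n → Bool) ℕ}
    {G : Matrix (Fin m' → Bool) (Fin n' → Bool) ℕ}
    (hX : Represents d X F) (hY : Represents d Y G) :
    Represents d (TL.tensor X Y) (kron F G) := by
  obtain ⟨k, a, rfl, rfl⟩ := hX
  obtain ⟨k', b, rfl, rfl⟩ := hY
  refine ⟨k + k', juxtapose a b, ?_, ?_⟩
  · rw [tensor_smul_left, tensor_smul_right, tensor_single, smul_smul, pow_add]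
  · rw [mat_juxtapose]
    funext i j
    simp only [kron, Matrix.smul_apply, smul_eq_mul]
    ring

theorem Represents.exists_Tr_eq {d : K} {n : ℕ} {X : Hom K n n}
    {F : Matrix (Fin n → Bool) (Fin n → Bool) ℕ} (hX : Represents d X F) :
    ∃ t : ℕ, Tr d X = d ^ t ∧ ∑ i, F i i = 2 ^ t := by
  obtain ⟨k, c, rfl, rfl⟩ := hX
  refine ⟨k + trLoops c, ?_, ?_⟩
  · rw [Tr_smul, pow_add]
    simp [Tr, single]
  · simp only [Matrix.smul_apply, ← Finset.smul_sum]
    rw [sum_mat_diag, smul_eq_mul, pow_add]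

theorem represents_idHom (d : K) (n : ℕ) :
    Represents d (idHom K n) (idMat n) := by
  rw [← mat_idD]; exact represents_single d _

theorem represents_capHom (d : K) :
    Represents d (capHom K) capMat := by
  rw [← mat_capD]; exact represents_single d _

theorem represents_cupHom (d : K) :
    Represents d (cupHom K) cupMat := by
  rw [← mat_cupD]; exact represents_single d _

/-- The extension of a two-colouring by the colour of one further point. -/
abbrev ext1 {n : ℕ} (i : Fin n → Bool) (s : Bool) : Fin (n + 1) → Bool :=
  Fin.snoc (α := fun _ => Bool) i s

theorem sum_ext1 {n : ℕ} (g : (Fin (n + 1) → Bool) → ℕ) :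
    ∑ z, g z = ∑ i, ∑ s, g (ext1 i s) := by
  rw [← (Fin.snocEquiv fun _ : Fin (n + 1) => Bool).sum_comp, Fintype.sum_prod_type_right]
  rfl

theorem ext1_castAdd {n : ℕ} (i : Fin n → Bool) (s : Bool) :
    (fun k => ext1 i s (Fin.castAdd 1 k)) = i := by
  funext k
  exact Fin.snoc_castSucc (α := fun _ => Bool) s i k

theorem ext1_natAdd {n : ℕ} (i : Fin n → Bool) (s : Bool) :
    (fun k : Fin 1 => ext1 i s (Fin.natAdd n k)) = fun _ => s := by
  funext k
  rw [Subsingleton.elim k (Fin.last 0)]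
  exact Fin.snoc_last (α := fun _ => Bool) s i

theorem ext1_ext1_castAdd {n : ℕ} (i : Fin n → Bool) (s t : Bool) :
    (fun k => (ext1 (ext1 i s) t : Fin (n + 2) → Bool) (Fin.castAdd 2 k)) = i := by
  funext k
  exact (congrFun (ext1_castAdd (ext1 i s) t) (Fin.castAdd 1 k)).trans
    (congrFun (ext1_castAdd i s) k)

theorem ext1_ext1_natAdd_zero {n : ℕ} (i : Fin n → Bool) (s t : Bool) :
    (ext1 (ext1 i s) t : Fin (n + 2) → Bool) (Fin.natAdd n (0 : Fin 2)) = s :=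
  (congrFun (ext1_castAdd (ext1 i s) t) (Fin.last n)).trans
    (Fin.snoc_last (α := fun _ => Bool) s i)

theorem ext1_ext1_natAdd_one {n : ℕ} (i : Fin n → Bool) (s t : Bool) :
    (ext1 (ext1 i s) t : Fin (n + 2) → Bool) (Fin.natAdd n (1 : Fin 2)) = t :=
  Fin.snoc_last (α := fun _ => Bool) t (ext1 i s)

theorem kron_one_ext1 {m n : ℕ} (F : Matrix (Fin m → Bool) (Fin n → Bool) ℕ)
    (i : Fin m → Bool) (j : Fin n → Bool) (s t : Bool) :
    kron F (idMat 1) (ext1 i s) (ext1 j t) =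
      if s = t then F i j else 0 := by
  rw [kron_apply, ext1_castAdd, ext1_castAdd, ext1_natAdd, ext1_natAdd]
  simp [idMat, funext_iff]

theorem idMat_succ (m : ℕ) : idMat (m + 1) = kron (idMat m) (idMat 1) := by
  funext i j
  rw [← Fin.snoc_init_self (α := fun _ => Bool) i, ← Fin.snoc_init_self (α := fun _ => Bool) j,
    kron_one_ext1]
  simp only [idMat, Fin.snoc_inj, ← ite_and, and_comm]

/-- The partial trace of a matrix over the last tensor factor. -/
def partialTrace {n : ℕ} (F : Matrix (Fin (n + 1) → Bool) (Fin (n + 1) → Bool) ℕ) :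
    Matrix (Fin n → Bool) (Fin n → Bool) ℕ :=
  fun i j => ∑ s, F (ext1 i s) (ext1 j s)

theorem Represents.eps {d : K} {n : ℕ} {X : Hom K (n + 1) (n + 1)}
    {F : Matrix (Fin (n + 1) → Bool) (Fin (n + 1) → Bool) ℕ} (hX : Represents d X F) :
    Represents d (TL.eps d n X) (partialTrace F) := by
  have hu := (represents_idHom d n).tensor (represents_capHom d)
  have hv := hX.tensor (represents_idHom d 1)
  have hw := (represents_idHom d n).tensor (represents_cupHom d)
  have h := Represents.comp (m := n + 2) (n := n) hw
    (Represents.comp (l := n) (m := n + 2) (n := n + 2) hv hu)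
  suffices hE : _ = partialTrace F by rw [← hE]; exact h
  have hU : ∀ i x s t, kron (n' := 2) (idMat n) capMat i (ext1 (n := n + 1) (ext1 (n := n) x s) t) =
      if i = x then (if s = t then 1 else 0) else 0 := by
    intro i x s t
    rw [kron_apply]
    have e := ext1_ext1_castAdd x s t
    have e0 := ext1_ext1_natAdd_zero x s t
    have e1 := ext1_ext1_natAdd_one x s t
    rw [e, capMat, e0, e1]
    change (if i = x then 1 else 0) * (if s = t then 1 else 0) = _
    simp only [ite_mul, one_mul, zero_mul]
  have hW : ∀ j x s t, kron (m' := 2) (idMat n) cupMat (ext1 (n := n + 1) (ext1 (n := n) x s) t) j =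
      if x = j then (if s = t then 1 else 0) else 0 := by
    intro j x s t
    rw [kron_apply]
    have e := ext1_ext1_castAdd x s t
    have e0 := ext1_ext1_natAdd_zero x s t
    have e1 := ext1_ext1_natAdd_one x s t
    rw [e, cupMat, e0, e1]
    change (if x = j then 1 else 0) * (if s = t then 1 else 0) = _
    simp only [ite_mul, one_mul, zero_mul]
  funext i j
  rw [Matrix.mul_apply, sum_ext1 (n := n + 1), sum_ext1]
  simp only [Matrix.mul_apply]
  simp only [sum_ext1 (n := n + 1)]
  simp only [sum_ext1 (n := n), hU, hW]
  simp only [kron_one_ext1, partialTrace]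
  simp [ite_mul, mul_ite]

theorem partialTrace_kron_mul {n : ℕ} (X Y : Matrix (Fin n → Bool) (Fin n → Bool) ℕ)
    (F : Matrix (Fin (n + 1) → Bool) (Fin (n + 1) → Bool) ℕ) :
    partialTrace (kron Y (idMat 1) * F *
      kron X (idMat 1)) =
    Y * partialTrace F * X := by
  funext i j
  simp only [Matrix.mul_apply, sum_ext1, kron_one_ext1, partialTrace]
  simp only [mul_ite, ite_mul, mul_zero, zero_mul, Finset.sum_ite_eq, Finset.sum_ite_eq',
    Finset.mem_univ, if_true]
  rw [Finset.sum_comm]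
  refine Finset.sum_congr rfl fun z _ => ?_
  rw [← Finset.sum_mul]
  congr 1
  rw [Finset.sum_comm]
  simp only [Finset.mul_sum]

theorem eps_tensor_comp (d : K) (n : ℕ) (x y : Hom K n n) (f : Hom K (n + 1) (n + 1)) :
    eps d n (comp d (tensor x (idHom K 1)) (comp d f (tensor y (idHom K 1)))) =
      comp d x (comp d (eps d n f) y) := by
  revert f
  refine eq_of_single (A := fun f => eps d n (comp d (tensor x (idHom K 1))
      (comp d f (tensor y (idHom K 1))))) (B := fun f => comp d x (comp d (eps d n f) y))
    ⟨?_, ?_⟩ ⟨?_, ?_⟩ fun f => ?_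
  iterate 4 simp [eps_add, eps_smul, comp_add_left, comp_add_right, comp_smul_left,
    comp_smul_right]
  revert y
  refine eq_of_single (A := fun y => eps d n (comp d (tensor x (idHom K 1))
      (comp d (single f) (tensor y (idHom K 1)))))
    (B := fun y => comp d x (comp d (eps d n (single f)) y)) ⟨?_, ?_⟩ ⟨?_, ?_⟩ fun y => ?_
  iterate 4 simp [eps_add, eps_smul, comp_add_right, comp_smul_right, tensor_add_left,
    tensor_smul_left]
  revert x
  refine eq_of_single (A := fun x => eps d n (comp d (tensor x (idHom K 1))
      (comp d (single f) (tensor (single y) (idHom K 1)))))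
    (B := fun x => comp d x (comp d (eps d n (single f)) (single y))) ⟨?_, ?_⟩ ⟨?_, ?_⟩
    fun x => ?_
  iterate 4 simp [eps_add, eps_smul, comp_add_left, comp_smul_left, tensor_add_left,
    tensor_smul_left]
  have hx := represents_single d x
  have hy := represents_single d y
  have hf := represents_single d f
  have h1 := represents_idHom d 1
  exact ((hx.tensor h1).comp (hf.comp (hy.tensor h1))).eps.unique (hx.comp (hf.eps.comp hy))
    (partialTrace_kron_mul _ _ _)

theorem Tr_eps (d : K) (n : ℕ) (f : Hom K (n + 1) (n + 1)) : Tr d (eps d n f) = Tr d f := by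
  revert f
  refine eq_of_single ⟨?_, ?_⟩ ⟨?_, ?_⟩ fun f => ?_
  iterate 4 simp [eps_add, eps_smul, Tr_add, Tr_smul]
  have hf := represents_single d f
  obtain ⟨t, h1, h2⟩ := hf.exists_Tr_eq
  obtain ⟨t', h1', h2'⟩ := hf.eps.exists_Tr_eq
  rw [h1, h1', Nat.pow_right_injective le_rfl (h2'.symm.trans (Eq.trans ?_ h2))]
  exact (sum_ext1 fun z => mat f z z).symm

theorem tensor_idHom_zero {n : ℕ} (x : Hom K n n) : tensor x (idHom K 0) = x := by
  revert x
  refine eq_of_single (A := fun x : Hom K n n => (tensor x (idHom K 0) : Hom K n n))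
    ⟨fun x y => tensor_add_left x y _, fun s x => tensor_smul_left s x _⟩
    ⟨fun _ _ => rfl, fun _ _ => rfl⟩ fun x => ?_
  have hx := represents_single (1 : K) x
  refine (hx.tensor (represents_idHom 1 0)).unique hx ?_
  funext i j
  rw [kron_apply, idMat, if_pos (Subsingleton.elim _ _), mul_one]
  rfl

theorem tensor_idHom_succ {n : ℕ} (x : Hom K n n) (m : ℕ) :
    tensor x (idHom K (m + 1)) = tensor (m := n + m) (n := n + m) (tensor x (idHom K m)) (idHom K 1) := by
  revert x
  refine eq_of_single (A := fun x : Hom K n n => tensor x (idHom K (m + 1)))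
    (B := fun x => tensor (m := n + m) (n := n + m) (tensor x (idHom K m)) (idHom K 1))
    ⟨fun x y => tensor_add_left x y _, fun s x => tensor_smul_left s x _⟩
    ⟨fun x y => ?_, fun s x => ?_⟩ fun x => ?_
  · exact (congrArg (fun z => tensor z (idHom K 1)) (tensor_add_left x y _)).trans
      (tensor_add_left _ _ _)
  · exact (congrArg (fun z => tensor z (idHom K 1)) (tensor_smul_left s x _)).trans
      (tensor_smul_left _ _ _)
  have hx := represents_single (1 : K) x
  refine (hx.tensor (represents_idHom 1 (m + 1))).unique
    ((hx.tensor (represents_idHom 1 m)).tensor (represents_idHom 1 1)) ?_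
  rw [idMat_succ]
  funext i j
  simp only [kron_apply, mul_assoc]
  have h : ∀ k : Fin 1, (Fin.natAdd n (Fin.natAdd m k) : Fin (n + (m + 1))) =
      (Fin.natAdd (n + m) k : Fin (n + m + 1)) := fun k => Fin.ext (Nat.add_assoc n m k).symm
  simp only [h]
  rfl

theorem epsIter_tensor_comp (d : K) (n m : ℕ) (p : Hom K n n) (f : Hom K (n + m) (n + m)) :
    epsIter d n m (comp d (tensor p (idHom K m)) (comp d f (tensor p (idHom K m)))) =
      comp d p (comp d (epsIter d n m f) p) := by
  induction m with
  | zero => rw [tensor_idHom_zero]; rfl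
  | succ m ih =>
    rw [tensor_idHom_succ]
    exact (congrArg (epsIter d n m) (eps_tensor_comp d (n + m) _ _ f)).trans (ih _)

theorem Tr_epsIter (d : K) (n m : ℕ) (f : Hom K (n + m) (n + m)) :
    Tr d (epsIter d n m f) = Tr d f := by
  induction m with
  | zero => rfl
  | succ m ih => exact (ih _).trans (Tr_eps d (n + m) f)

/-- Let `K` be a field, `d ∈ K`, `p ∈ T_n` a minimal idempotent,
and `f ∈ T_{n+m}` with `(p⊗1_m)∘f∘(p⊗1_m) = f`.  Then there is a scalar
`γ ∈ K` with `ε_{n,n+m}(f) = γ·p` and `Tr_{n+m}(f) = γ·Tr_n(p)`. -/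
theorem stmt6 (K : Type) [Field K] (d : K) (n m : ℕ)
    (p : Hom K n n) (f : Hom K (n + m) (n + m))
    (hidem : comp d p p = p)
    (hmin : (Set.range fun x : Hom K n n => comp d p (comp d x p)) =
      Set.range fun c : K => c • p)
    (hf : comp d (tensor p (idHom K m)) (comp d f (tensor p (idHom K m))) = f) :
    ∃ γ : K, epsIter d n m f = γ • p ∧ Tr d f = γ * Tr d p := by
  obtain ⟨γ, hγ⟩ : comp d p (comp d (epsIter d n m f) p) ∈ Set.range fun c : K => c • p :=
    hmin ▸ Set.mem_range_self (epsIter d n m f)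
  have h : epsIter d n m f = γ • p := by
    rw [← epsIter_tensor_comp, hf] at hγ
    exact hγ.symm
  exact ⟨γ, h, by rw [← Tr_epsIter, h, Tr_smul]⟩

end TL
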